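/- Let patterns be binary strings α ∈ {0,1}^k (k ≥ 1) with α_1 = α_k = 1. For counts n : Patterns → ℕ with finite support define the approximate Fock vector |n; n⟩ = (n!)^{-1/2} Π_α A*_α(n)^{n_α} Ω_n (product in a fixed order of patterns). Then lim_{n→∞} ⟨ m; n | n; n ⟩ = δ_{m,n} for all finitely supported counts m, n; i.e., the approximate Fock vectors become asymptotically orthonormal. -/

import Mathlib

/-- The vacuum `Ω_n = |0⟩^{⊗n}` of the spin chain, in the occupation-set representation
where a basis configuration is the (finite) set of sites carrying a `1`. -/
noncomputable def vac : Finset ℕ → ℂ := fun S => if S = ∅ then 1 else 0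

/-- The set of sites where the pattern `α` (a binary string) placed at starting position `i`
carries a `1`. -/
def onesOf (α : List Bool) (i : ℕ) : Finset ℕ :=
  ((Finset.range α.length).filter fun j => α.getD j false = true).image fun j => i + j

/-- The operator `σ^α_i`: the tensor product of `σ⁺ = |1⟩⟨0|` at the sites where `α` has a
`1` (shifted to start at position `i`) and the identity elsewhere. -/
noncomputable def patOp (α : List Bool) (i : ℕ) (ψ : Finset ℕ → ℂ) : Finset ℕ → ℂ :=
  fun S => if onesOf α i ⊆ S then ψ (S \ onesOf α i) else 0

/-- The translationally invariant creation operator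
`A*_α(n) = n^{-1/2} ∑_{i=1}^{n-|α|+1} σ^α_i`. -/
noncomputable def Astar (n : ℕ) (α : List Bool) (ψ : Finset ℕ → ℂ) : Finset ℕ → ℂ :=
  fun S => ((Real.sqrt n)⁻¹ : ℂ) *
    ∑ i ∈ Finset.range (n - α.length + 1), patOp α i ψ S

/-- The approximate Fock vector `|𝐧; n⟩ = (𝐧!)^{-1/2} ∏_j A*_{α_j}(n)^{c_j} Ω_n`, for the
counts assigning multiplicity `c j` to the pattern `α j`, the product taken in the fixed
order `j = 0, 1, …, p-1`. -/
noncomputable def fock (n : ℕ) {p : ℕ} (α : Fin p → List Bool) (c : Fin p → ℕ) :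
    Finset ℕ → ℂ :=
  fun S => ((Real.sqrt (∏ j, Nat.factorial (c j)))⁻¹ : ℂ) *
    ((List.ofFn fun j : Fin p => (Astar n (α j))^[c j]).foldr (· ∘ ·) id vac) S

section Patterns

lemma mem_onesOf {α : List Bool} {i s : ℕ} :
    s ∈ onesOf α i ↔ ∃ j < α.length, α.getD j false = true ∧ i + j = s := by
  simp [onesOf, and_assoc]

lemma left_mem_onesOf {α : List Bool} (hα : α.head? = some true) (i : ℕ) : i ∈ onesOf α i := by
  cases α with
  | nil => simp at hα
  | cons b t => exact mem_onesOf.2 ⟨0, by simp, by simpa using hα, by simp⟩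

lemma last_mem_onesOf {α : List Bool} (hα : α.getLast? = some true) (i : ℕ) :
    i + (α.length - 1) ∈ onesOf α i := by
  have hne : α ≠ [] := by rintro rfl; simp at hα
  have hpos := List.length_pos_iff.2 hne
  refine mem_onesOf.2 ⟨α.length - 1, by omega, ?_, rfl⟩
  rw [List.getLast?_eq_getElem?] at hα
  simp [List.getD, hα]

/-- A pattern starting and ending with `1` and its position are determined by the occupied
sites. -/
lemma onesOf_inj {α β : List Bool} (hα : α.head? = some true ∧ α.getLast? = some true)
    (hβ : β.head? = some true ∧ β.getLast? = some true) {i j : ℕ}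
    (h : onesOf α i = onesOf β j) : α = β ∧ i = j := by
  have le_of (γ : List Bool) {k s : ℕ} (hs : s ∈ onesOf γ k) : k ≤ s ∧ s < k + γ.length := by
    obtain ⟨t, ht, -, rfl⟩ := mem_onesOf.1 hs
    omega
  have hij : i = j := le_antisymm (le_of α (h ▸ left_mem_onesOf hβ.1 j)).1
    (le_of β (h ▸ left_mem_onesOf hα.1 i)).1
  subst hij
  have hlast := le_of β (h ▸ last_mem_onesOf hα.2 i)
  have hlast' := le_of α (h ▸ last_mem_onesOf hβ.2 i)
  have hlα := (le_of α (left_mem_onesOf hα.1 i)).2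
  have hlβ := (le_of β (left_mem_onesOf hβ.1 i)).2
  have hlen : α.length = β.length := by omega
  refine ⟨List.ext_getElem hlen fun k hk hk' => ?_, rfl⟩
  have key : α.getD k false = true ↔ β.getD k false = true := by
    have aux (γ : List Bool) (hkγ : k < γ.length) :
        γ.getD k false = true ↔ i + k ∈ onesOf γ i := by
      rw [mem_onesOf]
      constructor
      · exact fun hg => ⟨k, hkγ, hg, rfl⟩
      · rintro ⟨t, -, ht, hts⟩
        rwa [Nat.add_left_cancel hts] at ht
    rw [aux α hk, aux β hk', h]
  simp only [List.getD, List.getElem?_eq_getElem hk, List.getElem?_eq_getElem hk',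
    Option.getD_some] at key
  exact Bool.eq_iff_iff.2 key

/-- Overlapping patterns of bounded length sit at nearby positions. -/
lemma lt_add_of_not_disjoint_onesOf {α β : List Bool} {i j l : ℕ} (hα : α.length ≤ l)
    (h : ¬ Disjoint (onesOf α i) (onesOf β j)) : j < i + l := by
  obtain ⟨s, hs, hs'⟩ := Finset.not_disjoint_iff.1 h
  obtain ⟨t, ht, -, rfl⟩ := mem_onesOf.1 hs
  obtain ⟨u, -, -, hu⟩ := mem_onesOf.1 hs'
  omega

end Patterns

section Placements

variable {ι : Type*} [Fintype ι]

/-- The sites occupied by the patterns `a k` placed at the positions `x k`. -/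
def cover (a : ι → List Bool) (x : ι → ℕ) : Finset ℕ :=
  Finset.univ.biUnion fun k => onesOf (a k) (x k)

open Classical in
/-- The positions in a chain of length `n` at which the patterns `a k` can be placed
simultaneously, no site being occupied twice. -/
noncomputable def placements (n : ℕ) (a : ι → List Bool) : Finset (ι → ℕ) :=
  {x ∈ Fintype.piFinset fun k => Finset.range (n - (a k).length + 1) |
    Pairwise fun k l => Disjoint (onesOf (a k) (x k)) (onesOf (a l) (x l))}

lemma mem_placements {n : ℕ} {a : ι → List Bool} {x : ι → ℕ} :
    x ∈ placements n a ↔ (∀ k, x k < n - (a k).length + 1) ∧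
      Pairwise fun k l => Disjoint (onesOf (a k) (x k)) (onesOf (a l) (x l)) := by
  classical
  simp [placements]

lemma mem_cover {a : ι → List Bool} {x : ι → ℕ} {s : ℕ} :
    s ∈ cover a x ↔ ∃ k, s ∈ onesOf (a k) (x k) := by
  simp [cover]

lemma cover_cons (a : List Bool) (L : List (List Bool)) (x : Fin (L.length + 1) → ℕ) :
    cover (a :: L).get x = onesOf a (x 0) ∪ cover L.get (Fin.tail x) := by
  ext s
  simp only [mem_cover, Finset.mem_union]
  exact Fin.exists_fin_succ

lemma mem_placements_cons {n : ℕ} {a : List Bool} {L : List (List Bool)}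
    {x : Fin (L.length + 1) → ℕ} :
    x ∈ placements n (a :: L).get ↔ x 0 < n - a.length + 1 ∧
      Disjoint (onesOf a (x 0)) (cover L.get (Fin.tail x)) ∧
        Fin.tail x ∈ placements n L.get := by
  rw [mem_placements, mem_placements]
  constructor
  · rintro ⟨hx, hd⟩
    refine ⟨hx 0, ?_, fun k => hx k.succ, fun k l hkl => hd (by simpa using hkl)⟩
    rw [cover, Finset.disjoint_biUnion_right]
    exact fun k _ => hd (Fin.succ_ne_zero k).symm
  · rintro ⟨hx, h, hx', hd⟩
    rw [cover, Finset.disjoint_biUnion_right] at h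
    refine ⟨Fin.cases hx hx', fun k l hkl => ?_⟩
    cases k using Fin.cases with
    | zero =>
      cases l using Fin.cases with
      | zero => exact absurd rfl hkl
      | succ l => exact h l (Finset.mem_univ _)
    | succ k =>
      cases l using Fin.cases with
      | zero => exact (h k (Finset.mem_univ _)).symm
      | succ l => exact hd (by simpa using hkl)

/-- The creation operators applied to the vacuum count placements. -/
lemma foldr_Astar_vac (n : ℕ) (L : List (List Bool)) (S : Finset ℕ) :
    L.foldr (Astar n) vac S = ((Real.sqrt n)⁻¹ : ℂ) ^ L.length *
      (({x ∈ placements n L.get | cover L.get x = S} : Finset _).card : ℂ) := by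
  induction L generalizing S with
  | nil =>
    have h : placements n ([] : List (List Bool)).get = {Fin.elim0} := by
      ext x
      simp only [mem_placements, Finset.mem_singleton]
      exact ⟨fun _ => funext fun k => k.elim0, fun _ => ⟨fun k => k.elim0, fun k => k.elim0⟩⟩
    have h' (x) : cover ([] : List (List Bool)).get x = ∅ := by
      ext s
      simp only [mem_cover, Finset.notMem_empty, iff_false]
      rintro ⟨k, -⟩
      exact k.elim0
    rw [h]
    by_cases hS : S = ∅
    · simp [vac, hS, h', Finset.filter_singleton]
    · simp [vac, hS, h', Finset.filter_singleton, Ne.symm hS]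
  | cons a L ih =>
    have hcard : (({x ∈ placements n (a :: L).get | cover (a :: L).get x = S} : Finset _).card) =
        ∑ i ∈ Finset.range (n - a.length + 1), if onesOf a i ⊆ S then
          ({x ∈ placements n L.get | cover L.get x = S \ onesOf a i} : Finset _).card else 0 := by
      rw [Finset.card_eq_sum_card_fiberwise (f := fun x : Fin (L.length + 1) → ℕ => x 0)
        (t := Finset.range (n - a.length + 1))]
      · refine Finset.sum_congr rfl fun i hi => ?_
        rw [Finset.mem_range] at hi
        split_ifs with hS
        · refine Finset.card_bij' (fun x _ => Fin.tail x) (fun x _ => Fin.cons i x) ?_ ?_ ?_ ?_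
          · intro x hx
            obtain ⟨hxS, rfl⟩ := Finset.mem_filter.1 hx
            obtain ⟨hxp, rfl⟩ := Finset.mem_filter.1 hxS
            obtain ⟨-, hd, hxt⟩ := mem_placements_cons.1 hxp
            rw [Finset.mem_filter, cover_cons]
            exact ⟨hxt, (Finset.union_sdiff_cancel_left hd).symm⟩
          · intro x hx
            obtain ⟨hx, hc⟩ := Finset.mem_filter.1 hx
            refine Finset.mem_filter.2 ⟨Finset.mem_filter.2
              ⟨mem_placements_cons.2 ⟨hi, ?_, hx⟩, ?_⟩, rfl⟩
            · rw [Fin.tail_cons, hc]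
              exact Finset.disjoint_sdiff
            · rw [cover_cons, Fin.tail_cons, hc]
              exact Finset.union_sdiff_of_subset hS
          · intro x hx
            rw [← (Finset.mem_filter.1 hx).2]
            exact Fin.cons_self_tail x
          · intro x hx
            exact Fin.tail_cons _ _
        · rw [Finset.card_eq_zero, Finset.filter_eq_empty_iff]
          intro x hx hxi
          rw [Finset.mem_filter, cover_cons] at hx
          apply hS
          rw [← hx.2, ← hxi]
          exact Finset.subset_union_left
      · intro x hx
        rw [Finset.mem_coe, Finset.mem_filter, mem_placements_cons] at hx
        simpa using hx.1.1
    rw [List.foldr_cons, hcard, List.length_cons, pow_succ', mul_assoc, Nat.cast_sum,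
      Finset.mul_sum]
    simp only [Astar, patOp, ih]
    congr 1
    refine Finset.sum_congr rfl fun i _ => ?_
    split_ifs <;> simp

/-- The list of patterns with multiplicities. -/
def patternList {p : ℕ} (α : Fin p → List Bool) (c : Fin p → ℕ) : List (List Bool) :=
  (List.ofFn fun j => List.replicate (c j) (α j)).flatten

lemma foldr_flatten_replicate {X Y : Type*} (f : X → Y → Y) (l : List (ℕ × X)) (y : Y) :
    (l.map fun a => (f a.2)^[a.1]).foldr (· ∘ ·) id y =
      (l.map fun a => List.replicate a.1 a.2).flatten.foldr f y := by
  have hrep (k : ℕ) (x : X) (y : Y) : (List.replicate k x).foldr f y = (f x)^[k] y := by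
    induction k with
    | zero => rfl
    | succ k ih => rw [Function.iterate_succ_apply', ← ih]; rfl
  induction l with
  | nil => rfl
  | cons a l ih => simp [hrep, ih]

lemma fock_apply (n : ℕ) {p : ℕ} (α : Fin p → List Bool) (c : Fin p → ℕ) (S : Finset ℕ) :
    fock n α c S = ((Real.sqrt (∏ j, Nat.factorial (c j) : ℕ))⁻¹ *
      (Real.sqrt n)⁻¹ ^ (patternList α c).length *
      (({x ∈ placements n (patternList α c).get |
        cover (patternList α c).get x = S} : Finset _).card : ℝ) : ℝ) := by
  have h := foldr_flatten_replicate (Astar n) (List.ofFn fun j => (c j, α j)) vac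
  simp only [List.map_ofFn, Function.comp_def] at h
  have h' := foldr_Astar_vac n (patternList α c) S
  rw [patternList, ← h, ← patternList] at h'
  simp only [fock, Function.comp_def, h']
  push_cast
  ring

open Classical in
/-- The pairs of placements occupying the same sites. -/
noncomputable def coincidences {κ : Type*} [Fintype κ] (n : ℕ) (a : ι → List Bool)
    (b : κ → List Bool) : Finset ((ι → ℕ) × (κ → ℕ)) :=
  {z ∈ placements n a ×ˢ placements n b | cover a z.1 = cover b z.2}

lemma mem_coincidences {κ : Type*} [Fintype κ] {n : ℕ} {a : ι → List Bool}
    {b : κ → List Bool} {z : (ι → ℕ) × (κ → ℕ)} :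
    z ∈ coincidences n a b ↔
      z.1 ∈ placements n a ∧ z.2 ∈ placements n b ∧ cover a z.1 = cover b z.2 := by
  simp [coincidences, and_assoc]

lemma hasSum_card_mul_card {κ : Type*} [Fintype κ] (n : ℕ) (a : ι → List Bool)
    (b : κ → List Bool) :
    HasSum (fun S => (({y ∈ placements n b | cover b y = S} : Finset _).card : ℝ) *
      (({x ∈ placements n a | cover a x = S} : Finset _).card : ℝ))
      ((coincidences n a b).card : ℝ) := by
  classical
  have h : ((coincidences n a b).card : ℝ) = ∑ y ∈ placements n b, ∑ x ∈ placements n a,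
      if cover a x = cover b y then (1 : ℝ) else 0 := by
    rw [Finset.sum_comm, ← Finset.sum_product', coincidences, Finset.card_filter]
    push_cast
    rfl
  rw [h]
  simp only [Finset.card_filter, Nat.cast_sum, Nat.cast_ite, Nat.cast_one, Nat.cast_zero,
    Finset.sum_mul_sum]
  refine hasSum_sum fun y _ => hasSum_sum fun x _ => ?_
  convert hasSum_ite_eq (cover b y) (if cover a x = cover b y then (1 : ℝ) else 0) using 2 with S
  by_cases hS : S = cover b y
  · simp [hS]
  · simp [hS, Ne.symm hS]

lemma tsum_conj_fock_mul_fock (n : ℕ) {p q : ℕ} (α : Fin p → List Bool) (β : Fin q → List Bool)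
    (c : Fin p → ℕ) (d : Fin q → ℕ) :
    ∑' S : Finset ℕ, (starRingEnd ℂ) (fock n β d S) * fock n α c S =
      (((Real.sqrt (∏ j, Nat.factorial (c j) : ℕ))⁻¹ *
        (Real.sqrt (∏ j, Nat.factorial (d j) : ℕ))⁻¹ *
        ((coincidences n (patternList α c).get (patternList β d).get).card *
          (Real.sqrt n)⁻¹ ^ ((patternList α c).length + (patternList β d).length)) : ℝ) : ℂ) := by
  simp only [fock_apply, Complex.conj_ofReal, ← Complex.ofReal_mul]
  rw [← Complex.ofReal_tsum]
  congr 1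
  rw [← (hasSum_card_mul_card n (patternList α c).get (patternList β d).get).tsum_eq,
    ← tsum_mul_right, ← tsum_mul_left]
  congr 1
  ext S
  ring

end Placements

/-- Positions whose pairwise distances are at least `g`. -/
def Separated {κ : Type*} (g : ℕ) (y : κ → ℕ) : Prop :=
  Pairwise fun i j => y i + g ≤ y j ∨ y j + g ≤ y i

lemma Separated.eq_of_lt {κ : Type*} {g : ℕ} {y : κ → ℕ} (hy : Separated g y) {i j : κ}
    (h : y i < y j + g) (h' : y j < y i + g) : i = j := by
  by_contra hij
  rcases hy hij with h | h <;> omega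

section Counting

variable {ι κ : Type*} [Fintype ι] [Fintype κ] {a : ι → List Bool} {b : κ → List Bool}

lemma exists_not_disjoint_of_cover_eq (ha : ∀ k, (a k).head? = some true)
    {x : ι → ℕ} {y : κ → ℕ} (h : cover a x = cover b y) (k : ι) :
    ∃ j, ¬ Disjoint (onesOf (a k) (x k)) (onesOf (b j) (y j)) := by
  have hk := left_mem_onesOf (ha k) (x k)
  obtain ⟨j, hj⟩ := mem_cover.1 (h ▸ mem_cover.2 ⟨k, hk⟩ : x k ∈ cover b y)
  exact ⟨j, Finset.not_disjoint_iff.2 ⟨_, hk, hj⟩⟩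

/-- Given the positions of one family of patterns, only boundedly many placements of another
family occupy the same sites. -/
lemma card_le_of_snd_mem {l n : ℕ} (ha : ∀ k, (a k).head? = some true)
    (hal : ∀ k, (a k).length ≤ l) (hbl : ∀ k, (b k).length ≤ l)
    {s : Finset ((ι → ℕ) × (κ → ℕ))} (hs : s ⊆ coincidences n a b) {Y : Finset (κ → ℕ)}
    (hY : ∀ z ∈ s, z.2 ∈ Y) :
    s.card ≤ (Fintype.card κ * (2 * l)) ^ Fintype.card ι * Y.card := by
  classical
  refine Finset.card_le_mul_card_image_of_maps_to hY _ fun y _ => ?_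
  have hsub : ({z ∈ s | z.2 = y} : Finset _).card ≤ (Fintype.piFinset fun _ : ι =>
      Finset.univ.biUnion fun j => Finset.Ico (y j - l) (y j + l)).card := by
    refine Finset.card_le_card_of_injOn Prod.fst ?_ ?_
    · rintro ⟨x, y'⟩ hz
      obtain ⟨hzs, rfl⟩ := Finset.mem_filter.1 (Finset.mem_coe.1 hz)
      rw [Finset.mem_coe, Fintype.mem_piFinset]
      intro k
      obtain ⟨j, hj⟩ :=
        exists_not_disjoint_of_cover_eq ha (mem_coincidences.1 (hs hzs)).2.2 k
      have h₁ := lt_add_of_not_disjoint_onesOf (hal k) hj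
      have h₂ := lt_add_of_not_disjoint_onesOf (hbl j) (fun h => hj h.symm)
      simp only [Finset.mem_biUnion, Finset.mem_univ, true_and, Finset.mem_Ico]
      exact ⟨j, Nat.sub_le_of_le_add h₁.le, h₂⟩
    · intro z hz z' hz' h
      exact Prod.ext h ((Finset.mem_filter.1 hz).2.trans (Finset.mem_filter.1 hz').2.symm)
  refine hsub.trans ?_
  rw [Fintype.card_piFinset, Finset.prod_const, Finset.card_univ]
  refine Nat.pow_le_pow_left (Finset.card_biUnion_le_card_mul _ _ _ fun j _ => ?_) _
  rw [Nat.card_Ico]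
  omega

lemma card_coincidences_comm (n : ℕ) (a : ι → List Bool) (b : κ → List Bool) :
    (coincidences n a b).card = (coincidences n b a).card := by
  refine Finset.card_bij' (fun z _ => z.swap) (fun z _ => z.swap) ?_ ?_ ?_ ?_ <;>
    simp +contextual [mem_coincidences]

open Classical in
lemma placements_subset {n : ℕ} (hn : 0 < n) (hb : ∀ k, (b k).head? = some true) :
    placements n b ⊆ Fintype.piFinset fun _ => Finset.range n := by
  intro y hy
  rw [Fintype.mem_piFinset]
  intro k
  have h := (mem_placements.1 hy).1 k
  have hk : 0 < (b k).length := by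
    rw [List.length_pos_iff]
    intro h
    simpa [h] using hb k
  rw [Finset.mem_range]
  omega

lemma card_coincidences_le {l n : ℕ} (hn : 0 < n) (ha : ∀ k, (a k).head? = some true)
    (hb : ∀ k, (b k).head? = some true)
    (hal : ∀ k, (a k).length ≤ l) (hbl : ∀ k, (b k).length ≤ l) :
    (coincidences n a b).card ≤
      (Fintype.card κ * (2 * l)) ^ Fintype.card ι * n ^ Fintype.card κ := by
  classical
  have h := card_le_of_snd_mem ha hal hbl (subset_refl (coincidences n a b))
    (Y := Fintype.piFinset fun _ => Finset.range n)
    fun z hz => placements_subset hn hb (mem_coincidences.1 hz).2.1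
  rwa [Fintype.card_piFinset, Finset.prod_const, Finset.card_univ, Finset.card_range] at h

lemma card_near_mul_le [DecidableEq κ] (g n : ℕ) {i j : κ} (hij : i ≠ j) :
    ({y ∈ Fintype.piFinset fun _ : κ => Finset.range n |
      y i < y j + g ∧ y j < y i + g} : Finset _).card * n ≤ 2 * g * n ^ Fintype.card κ := by
  have h : ({y ∈ Fintype.piFinset fun _ : κ => Finset.range n |
      y i < y j + g ∧ y j < y i + g} : Finset _).card ≤
      2 * g * (Fintype.piFinset fun _ : {k // k ≠ i} => Finset.range n).card := by
    refine Finset.card_le_mul_card_image_of_maps_to (f := fun y k => y k.1) ?_ _ fun w _ => ?_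
    · intro y hy
      have hy' := Fintype.mem_piFinset.1 (Finset.mem_filter.1 hy).1
      exact Fintype.mem_piFinset.2 fun k => hy' k
    · calc _ ≤ (Finset.Ico (w ⟨j, hij.symm⟩ - g) (w ⟨j, hij.symm⟩ + g)).card := by
            refine Finset.card_le_card_of_injOn (fun y => y i) ?_ ?_
            · intro y hy
              obtain ⟨hyn, rfl⟩ := Finset.mem_filter.1 (Finset.mem_coe.1 hy)
              have hij := (Finset.mem_filter.1 hyn).2
              rw [Finset.mem_coe, Finset.mem_Ico]
              exact ⟨Nat.sub_le_of_le_add hij.2.le, hij.1⟩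
            · intro y hy y' hy' h
              have hw := (Finset.mem_filter.1 hy).2.trans (Finset.mem_filter.1 hy').2.symm
              funext k
              by_cases hk : k = i
              · exact hk ▸ h
              · exact congrFun hw ⟨k, hk⟩
        _ ≤ 2 * g := by rw [Nat.card_Ico]; omega
  rw [Fintype.card_piFinset, Finset.prod_const, Finset.card_univ, Finset.card_range] at h
  have hc : Fintype.card {k // k ≠ i} + 1 = Fintype.card κ := by
    rw [Fintype.card_subtype_compl, Fintype.card_subtype_eq]
    exact Nat.sub_add_cancel (Fintype.card_pos_iff.2 ⟨i⟩)
  calc _ ≤ _ := Nat.mul_le_mul_right n h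
    _ = _ := by rw [← hc, pow_succ]; ring

open Classical in
lemma card_not_separated_mul_le (κ : Type*) [Fintype κ] (g n : ℕ) :
    ({y ∈ Fintype.piFinset fun _ : κ => Finset.range n | ¬ Separated g y} : Finset _).card * n ≤
      Fintype.card (κ × κ) * (2 * g) * n ^ Fintype.card κ := by
  have hsub : ({y ∈ Fintype.piFinset fun _ : κ => Finset.range n | ¬ Separated g y} : Finset _) ⊆
      ({p | p.1 ≠ p.2} : Finset (κ × κ)).biUnion fun p =>
        {y ∈ Fintype.piFinset fun _ : κ => Finset.range n |
          y p.1 < y p.2 + g ∧ y p.2 < y p.1 + g} := by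
    intro y hy
    obtain ⟨hy, hs⟩ := Finset.mem_filter.1 hy
    simp only [Separated, Pairwise, not_forall, not_or, not_le] at hs
    obtain ⟨i, j, hij, h, h'⟩ := hs
    exact Finset.mem_biUnion.2 ⟨(i, j), by simpa using hij, Finset.mem_filter.2 ⟨hy, h', h⟩⟩
  refine (Nat.mul_le_mul_right n
    ((Finset.card_le_card hsub).trans Finset.card_biUnion_le)).trans ?_
  rw [Finset.sum_mul]
  calc
    _ ≤ ∑ p ∈ ({p | p.1 ≠ p.2} : Finset (κ × κ)), 2 * g * n ^ Fintype.card κ :=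
        Finset.sum_le_sum fun p hp => card_near_mul_le g n (by simpa using hp)
    _ ≤ Fintype.card (κ × κ) * (2 * g) * n ^ Fintype.card κ := by
        rw [Finset.sum_const, smul_eq_mul, mul_assoc (Fintype.card _)]
        exact Nat.mul_le_mul_right _ (Finset.card_le_univ _)

lemma Separated.mem_placements {l n : ℕ} (hbl : ∀ k, (b k).length ≤ l) {y : κ → ℕ}
    (hy : Separated (2 * l) y) :
    y ∈ placements n b ↔ ∀ k, y k < n - (b k).length + 1 := by
  rw [_root_.mem_placements, and_iff_left]
  intro i j hij
  by_contra h
  have h₁ := lt_add_of_not_disjoint_onesOf (hbl i) h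
  have h₂ := lt_add_of_not_disjoint_onesOf (hbl j) (fun h' => h h'.symm)
  exact hij (hy.eq_of_lt (by omega) (by omega))

/-- A placement occupying the same sites as a separated family, with equally many patterns, is
obtained from it by reindexing. -/
lemma Separated.exists_equiv {l : ℕ}
    (ha : ∀ k, (a k).head? = some true ∧ (a k).getLast? = some true)
    (hb : ∀ k, (b k).head? = some true ∧ (b k).getLast? = some true)
    (hal : ∀ k, (a k).length ≤ l) (hbl : ∀ k, (b k).length ≤ l)
    (hcard : Fintype.card ι = Fintype.card κ) {x : ι → ℕ} {y : κ → ℕ}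
    (hy : Separated (2 * l) y) (h : cover a x = cover b y) :
    ∃ f : ι ≃ κ, (∀ k, b (f k) = a k) ∧ x = y ∘ f := by
  choose f hf using exists_not_disjoint_of_cover_eq (fun k => (ha k).1) h
  have huniq {k : ι} {j : κ} (hj : ¬ Disjoint (onesOf (a k) (x k)) (onesOf (b j) (y j))) :
      f k = j := by
    have h₁ := lt_add_of_not_disjoint_onesOf (hal k) hj
    have h₂ := lt_add_of_not_disjoint_onesOf (hbl j) (fun h => hj h.symm)
    have h₃ := lt_add_of_not_disjoint_onesOf (hal k) (hf k)
    have h₄ := lt_add_of_not_disjoint_onesOf (hbl (f k)) (fun h => hf k h.symm)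
    exact hy.eq_of_lt (by omega) (by omega)
  have hsurj : Function.Surjective f := fun j => by
    obtain ⟨k, hk⟩ := exists_not_disjoint_of_cover_eq (fun k => (hb k).1) h.symm j
    exact ⟨k, huniq fun h' => hk h'.symm⟩
  have hbij := (Fintype.bijective_iff_surjective_and_card f).2 ⟨hsurj, hcard⟩
  have hones (k : ι) : onesOf (b (f k)) (y (f k)) = onesOf (a k) (x k) := by
    ext s
    constructor
    · intro hs
      obtain ⟨k', hk'⟩ := mem_cover.1 (h.symm ▸ mem_cover.2 ⟨f k, hs⟩ : s ∈ cover a x)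
      rwa [← hbij.1 (huniq (Finset.not_disjoint_iff.2 ⟨s, hk', hs⟩))]
    · intro hs
      obtain ⟨j, hj⟩ := mem_cover.1 (h ▸ mem_cover.2 ⟨k, hs⟩ : s ∈ cover b y)
      rwa [huniq (Finset.not_disjoint_iff.2 ⟨s, hs, hj⟩)]
  refine ⟨Equiv.ofBijective f hbij, fun k => (onesOf_inj (hb _) (ha k) (hones k)).1, ?_⟩
  exact funext fun k => (onesOf_inj (hb _) (ha k) (hones k)).2.symm

lemma cover_comp_equiv (f : ι ≃ κ) (hf : ∀ k, b (f k) = a k) (y : κ → ℕ) :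
    cover a (y ∘ f) = cover b y := by
  ext s
  simp only [mem_cover, Function.comp_apply, ← hf]
  exact f.exists_congr_left.trans (by simp)

open Classical in
lemma card_separated_coincidences {l : ℕ} (n : ℕ)
    (ha : ∀ k, (a k).head? = some true ∧ (a k).getLast? = some true)
    (hb : ∀ k, (b k).head? = some true ∧ (b k).getLast? = some true)
    (hal : ∀ k, (a k).length ≤ l) (hbl : ∀ k, (b k).length ≤ l) (hl : 0 < l)
    (hcard : Fintype.card ι = Fintype.card κ) :
    ({z ∈ coincidences n a b | Separated (2 * l) z.2} : Finset _).card =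
      Nat.card {f : ι ≃ κ // ∀ k, b (f k) = a k} *
        ({y ∈ Fintype.piFinset fun k => Finset.range (n - (b k).length + 1) |
          Separated (2 * l) y} : Finset _).card := by
  rw [Nat.card_eq_fintype_card, ← Finset.card_univ, ← Finset.card_product]
  symm
  refine Finset.card_bij (fun z _ => (z.2 ∘ z.1.1, z.2)) ?_ ?_ ?_
  · rintro ⟨⟨f, hf⟩, y⟩ hz
    simp only [Finset.mem_product, Finset.mem_univ, true_and, Finset.mem_filter,
      Fintype.mem_piFinset, Finset.mem_range] at hz
    rw [Finset.mem_filter, mem_coincidences]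
    have hy := (hz.2.mem_placements hbl).2 hz.1
    refine ⟨⟨?_, hy, cover_comp_equiv f hf y⟩, hz.2⟩
    rw [mem_placements] at hy ⊢
    simp only [← hf]
    exact ⟨fun k => hy.1 (f k), fun i j hij => hy.2 (f.injective.ne hij)⟩
  · rintro ⟨⟨f, hf⟩, y⟩ hz ⟨⟨f', hf'⟩, y'⟩ hz' h
    obtain ⟨h, rfl⟩ := Prod.mk.inj h
    have hs : Separated (2 * l) y := (Finset.mem_filter.1 (Finset.mem_product.1 hz).2).2
    have hff : f = f' := by
      ext k
      have hk : y (f k) = y (f' k) := congrFun h k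
      clear h
      exact hs.eq_of_lt (by omega) (by omega)
    subst hff
    rfl
  · rintro ⟨x, y⟩ hz
    obtain ⟨hz, hs⟩ := Finset.mem_filter.1 hz
    obtain ⟨-, hy, hc⟩ := mem_coincidences.1 hz
    obtain ⟨f, hf, hx⟩ := Separated.exists_equiv ha hb hal hbl hcard hs hc
    refine ⟨(⟨f, hf⟩, y), ?_, Prod.ext hx.symm rfl⟩
    simpa [hs] using (mem_placements.1 hy).1

end Counting

section Limit

open Filter Topology

variable {ι κ : Type*} [Fintype ι] [Fintype κ] {a : ι → List Bool} {b : κ → List Bool}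

lemma tendsto_sub_add_one_div (m : ℕ) :
    Tendsto (fun n : ℕ => ((n - m + 1 : ℕ) : ℝ) / n) atTop (𝓝 1) := by
  have h : Tendsto (fun n : ℕ => 1 - ((m : ℝ) - 1) / n) atTop (𝓝 (1 - 0)) :=
    tendsto_const_nhds.sub (tendsto_const_div_atTop_nhds_zero_nat _)
  rw [sub_zero] at h
  refine h.congr' ?_
  filter_upwards [eventually_ge_atTop m, eventually_gt_atTop 0] with n hn hn0
  have : (n : ℝ) ≠ 0 := by positivity
  push_cast [hn]
  field_simp
  ring

lemma inv_sqrt_pow_add_self (n m : ℕ) : (Real.sqrt n)⁻¹ ^ (m + m) = ((n : ℝ) ^ m)⁻¹ := by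
  rw [← two_mul, pow_mul, inv_pow, Real.sq_sqrt n.cast_nonneg, inv_pow]

lemma abs_sub_le_of_card_bounds {C K D n s t u v : ℕ} {m : ℝ} (hn : 0 < n) (hm : 0 < m)
    (hs : (s : ℝ) * n ≤ D * m) (ht : t ≤ s) (hv : v ≤ K * s) :
    |(C : ℝ) * (((u + t : ℕ) : ℝ) / m) - ((C * u + v : ℕ) : ℝ) * m⁻¹| ≤ (K + C) * D / n := by
  have hn' : (0 : ℝ) < n := Nat.cast_pos.2 hn
  have ht' : (t : ℝ) ≤ s := Nat.cast_le.2 ht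
  have hv' : (v : ℝ) ≤ K * s := by exact_mod_cast hv
  have hCt : (C : ℝ) * t ≤ C * s := mul_le_mul_of_nonneg_left ht' C.cast_nonneg
  have h : |(C : ℝ) * t - v| ≤ (K + C) * s := by
    rw [abs_le]
    constructor
    · linarith [mul_nonneg (C.cast_nonneg (α := ℝ)) t.cast_nonneg,
        mul_nonneg (C.cast_nonneg (α := ℝ)) s.cast_nonneg]
    · linarith [v.cast_nonneg (α := ℝ), mul_nonneg (K.cast_nonneg (α := ℝ)) s.cast_nonneg]
  have heq : (C : ℝ) * (((u + t : ℕ) : ℝ) / m) - ((C * u + v : ℕ) : ℝ) * m⁻¹ =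
      (C * t - v) / m := by
    push_cast
    ring
  rw [heq, abs_div, abs_of_pos hm]
  calc _ ≤ (K + C) * s / m := by gcongr
    _ = (K + C) * (s / m) := mul_div_assoc _ _ _
    _ ≤ (K + C) * (D / n) := by
        refine mul_le_mul_of_nonneg_left ?_ (by positivity)
        rwa [div_le_div_iff₀ hm hn']
    _ = _ := (mul_div_assoc _ _ _).symm

lemma tendsto_card_coincidences_of_card_eq
    (ha : ∀ k, (a k).head? = some true ∧ (a k).getLast? = some true)
    (hb : ∀ k, (b k).head? = some true ∧ (b k).getLast? = some true)
    (hcard : Fintype.card ι = Fintype.card κ) :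
    Tendsto (fun n : ℕ => ((coincidences n a b).card : ℝ) *
      (Real.sqrt n)⁻¹ ^ (Fintype.card ι + Fintype.card κ)) atTop
      (𝓝 (Nat.card {f : ι ≃ κ // ∀ k, b (f k) = a k})) := by
  classical
  obtain ⟨l, hl, hal, hbl⟩ : ∃ l, 0 < l ∧ (∀ k, (a k).length ≤ l) ∧ ∀ k, (b k).length ≤ l :=
    ⟨∑ k, (a k).length + ∑ k, (b k).length + 1, by omega,
      fun k => (Finset.single_le_sum (f := fun k => (a k).length) (fun _ _ => Nat.zero_le _)
        (Finset.mem_univ k)).trans (by omega),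
      fun k => (Finset.single_le_sum (f := fun k => (b k).length) (fun _ _ => Nat.zero_le _)
        (Finset.mem_univ k)).trans (by omega)⟩
  set C := Nat.card {f : ι ≃ κ // ∀ k, b (f k) = a k}
  set K := (Fintype.card κ * (2 * l)) ^ Fintype.card ι
  set D := Fintype.card (κ × κ) * (2 * (2 * l))
  have hP : Tendsto (fun n : ℕ => (C : ℝ) * ∏ k, (((n - (b k).length + 1 : ℕ) : ℝ) / n)) atTop
      (𝓝 C) := by
    simpa using (tendsto_finsetProd Finset.univ fun k _ =>
      tendsto_sub_add_one_div (b k).length).const_mul (C : ℝ)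
  refine tendsto_of_tendsto_of_dist hP (squeeze_zero' (Eventually.of_forall fun _ => dist_nonneg) ?_
    (tendsto_const_div_atTop_nhds_zero_nat (((K : ℝ) + C) * D)))
  filter_upwards [eventually_gt_atTop 0] with n hn
  set U : Finset (κ → ℕ) :=
    {y ∈ Fintype.piFinset fun _ => Finset.range n | ¬ Separated (2 * l) y}
  have hU : U.card * n ≤ D * n ^ Fintype.card κ := card_not_separated_mul_le κ (2 * l) n
  have hsplit := Finset.card_filter_add_card_filter_not (s := coincidences n a b)
    (fun z => Separated (2 * l) z.2)
  rw [card_separated_coincidences n ha hb hal hbl hl hcard] at hsplit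
  have hbad : ({z ∈ coincidences n a b | ¬ Separated (2 * l) z.2} : Finset _).card ≤
      K * U.card := by
    refine card_le_of_snd_mem (fun k => (ha k).1) hal hbl (Finset.filter_subset _ _) fun z hz => ?_
    obtain ⟨hz, hs⟩ := Finset.mem_filter.1 hz
    exact Finset.mem_filter.2
      ⟨placements_subset hn (fun k => (hb k).1) (mem_coincidences.1 hz).2.1, hs⟩
  have hsplit' := Finset.card_filter_add_card_filter_not
    (s := Fintype.piFinset fun k => Finset.range (n - (b k).length + 1)) (Separated (2 * l))
  have hbad' : ({y ∈ Fintype.piFinset fun k => Finset.range (n - (b k).length + 1) |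
      ¬ Separated (2 * l) y} : Finset _).card ≤ U.card := by
    refine Finset.card_le_card (Finset.filter_subset_filter _
      (Fintype.piFinset_subset _ _ fun k => Finset.range_mono ?_))
    have hk : 0 < (b k).length := List.length_pos_iff.2 fun h => by simpa [h] using (hb k).1
    omega
  rw [Fintype.card_piFinset] at hsplit'
  simp only [Finset.card_range] at hsplit'
  rw [hcard, inv_sqrt_pow_add_self, Finset.prod_div_distrib, Finset.prod_const, Finset.card_univ,
    Real.dist_eq, ← Nat.cast_prod, ← hsplit, ← hsplit']
  exact abs_sub_le_of_card_bounds hn (pow_pos (Nat.cast_pos.2 hn) _) (by exact_mod_cast hU) hbad'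
    hbad

lemma tendsto_card_coincidences_of_card_lt
    (ha : ∀ k, (a k).head? = some true) (hb : ∀ k, (b k).head? = some true)
    (hcard : Fintype.card κ < Fintype.card ι) :
    Tendsto (fun n : ℕ => ((coincidences n a b).card : ℝ) *
      (Real.sqrt n)⁻¹ ^ (Fintype.card ι + Fintype.card κ)) atTop (𝓝 0) := by
  obtain ⟨l, hal, hbl⟩ : ∃ l, (∀ k, (a k).length ≤ l) ∧ ∀ k, (b k).length ≤ l :=
    ⟨∑ k, (a k).length + ∑ k, (b k).length,
      fun k => (Finset.single_le_sum (f := fun k => (a k).length) (fun _ _ => Nat.zero_le _)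
        (Finset.mem_univ k)).trans (by omega),
      fun k => (Finset.single_le_sum (f := fun k => (b k).length) (fun _ _ => Nat.zero_le _)
        (Finset.mem_univ k)).trans (by omega)⟩
  have hlim : Tendsto (fun n : ℕ =>
      (((Fintype.card κ * (2 * l)) ^ Fintype.card ι : ℕ) : ℝ) * (Real.sqrt n)⁻¹) atTop (𝓝 0) := by
    simpa using (tendsto_inv_atTop_zero.comp
      (Real.tendsto_sqrt_atTop.comp tendsto_natCast_atTop_atTop)).const_mul
        (((Fintype.card κ * (2 * l)) ^ Fintype.card ι : ℕ) : ℝ)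
  refine squeeze_zero' (Eventually.of_forall fun n => by positivity) ?_ hlim
  filter_upwards [eventually_gt_atTop 0] with n hn
  have h : ((coincidences n a b).card : ℝ) ≤
      (((Fintype.card κ * (2 * l)) ^ Fintype.card ι : ℕ) : ℝ) * (n : ℝ) ^ Fintype.card κ := by
    exact_mod_cast card_coincidences_le hn ha hb hal hbl
  have hn' : (1 : ℝ) ≤ n := by exact_mod_cast hn
  have hs : (Real.sqrt n)⁻¹ ≤ 1 := inv_le_one_of_one_le₀ (Real.one_le_sqrt.2 hn')
  calc _ ≤ (((Fintype.card κ * (2 * l)) ^ Fintype.card ι : ℕ) : ℝ) * (n : ℝ) ^ Fintype.card κ *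
          (Real.sqrt n)⁻¹ ^ (Fintype.card κ + Fintype.card κ + 1) :=
        mul_le_mul h (pow_le_pow_of_le_one (by positivity) hs (by omega)) (by positivity)
          (by positivity)
    _ = _ := by
        rw [pow_succ, inv_sqrt_pow_add_self, mul_assoc,
          mul_inv_cancel_left₀ (pow_ne_zero _ (by positivity))]

/-- The rescaled number of coincidences converges to the number of pattern-preserving
bijections. -/
lemma tendsto_card_coincidences
    (ha : ∀ k, (a k).head? = some true ∧ (a k).getLast? = some true)
    (hb : ∀ k, (b k).head? = some true ∧ (b k).getLast? = some true) :
    Tendsto (fun n : ℕ => ((coincidences n a b).card : ℝ) *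
      (Real.sqrt n)⁻¹ ^ (Fintype.card ι + Fintype.card κ)) atTop
      (𝓝 (Nat.card {f : ι ≃ κ // ∀ k, b (f k) = a k})) := by
  by_cases hcard : Fintype.card ι = Fintype.card κ
  · exact tendsto_card_coincidences_of_card_eq ha hb hcard
  have : IsEmpty {f : ι ≃ κ // ∀ k, b (f k) = a k} :=
    ⟨fun f => hcard (Fintype.card_congr f.1)⟩
  rw [Nat.card_of_isEmpty, Nat.cast_zero]
  rcases Nat.lt_or_gt_of_ne hcard with h | h
  · simp only [card_coincidences_comm _ a b, add_comm (Fintype.card ι)]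
    exact tendsto_card_coincidences_of_card_lt (fun k => (hb k).1) (fun k => (ha k).1) h
  · exact tendsto_card_coincidences_of_card_lt (fun k => (ha k).1) (fun k => (hb k).1) h

end Limit

section Matchings

variable {p q : ℕ} {α : Fin p → List Bool} {β : Fin q → List Bool} {c : Fin p → ℕ} {d : Fin q → ℕ}

lemma count_patternList (w : List Bool) :
    (patternList α c).count w = ∑ j, if α j = w then c j else 0 := by
  rw [patternList, List.count_flatten, List.map_ofFn, List.sum_ofFn]
  simp [List.count_replicate]

lemma count_patternList_apply (hα : Function.Injective α) (j : Fin p) :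
    (patternList α c).count (α j) = c j := by
  simp [count_patternList, hα.eq_iff]

lemma mem_patternList (hc : ∀ j, 0 < c j) {w : List Bool} :
    w ∈ patternList α c ↔ ∃ j, α j = w := by
  simp only [patternList, List.mem_flatten, List.mem_ofFn]
  constructor
  · rintro ⟨_, ⟨j, rfl⟩, hw⟩
    exact ⟨j, (List.eq_of_mem_replicate hw).symm⟩
  · rintro ⟨j, rfl⟩
    exact ⟨_, ⟨j, rfl⟩, List.mem_replicate.2 ⟨(hc j).ne', rfl⟩⟩

lemma card_get_eq {X : Type*} [BEq X] [LawfulBEq X] (L : List X) (w : X) :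
    Nat.card {k // L.get k = w} = L.count w := by
  classical
  have h := Multiset.count_map (fun k => L.get k) Finset.univ.val w
  rw [Fin.univ_val_map, List.ofFn_get, Multiset.coe_count] at h
  rw [Nat.card_eq_fintype_card, Fintype.card_subtype]
  convert h.symm using 1
  · simp only [eq_comm]
    rfl
  · congr 1
    exact lawful_beq_subsingleton _ _

lemma perm_of_equiv {X : Type*} {L L' : List X} (f : Fin L.length ≃ Fin L'.length)
    (hf : ∀ k, L'.get (f k) = L.get k) : L.Perm L' := by
  classical
  rw [List.perm_iff_count]
  intro w
  rw [← card_get_eq, ← card_get_eq]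
  exact Nat.card_congr (f.subtypeEquiv fun k => by rw [hf])

lemma exists_equiv_of_perm (hα : Function.Injective α) (hβ : Function.Injective β)
    (hc : ∀ j, 0 < c j) (hd : ∀ j, 0 < d j) (h : (patternList α c).Perm (patternList β d)) :
    ∃ e : Fin p ≃ Fin q, ∀ j, β (e j) = α j ∧ d (e j) = c j := by
  choose e he using fun j => (mem_patternList hd).1 (h.mem_iff.1 ((mem_patternList hc).2 ⟨j, rfl⟩))
  choose e' he' using
    fun j => (mem_patternList hc).1 (h.mem_iff.2 ((mem_patternList hd).2 ⟨j, rfl⟩))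
  refine ⟨⟨e, e', fun j => hα (by rw [he', he]), fun j => hβ (by rw [he, he'])⟩,
    fun j => ⟨he j, ?_⟩⟩
  rw [← count_patternList_apply hβ (c := d), ← count_patternList_apply hα (c := c)]
  exact (congrArg (fun w => (patternList β d).count w) (he j)).trans (h.count_eq _).symm

lemma card_matchings (hα : Function.Injective α) (hc : ∀ j, 0 < c j)
    (h : (patternList α c).Perm (patternList β d)) :
    Nat.card {f : Fin (patternList α c).length ≃ Fin (patternList β d).length //
      ∀ k, (patternList β d).get (f k) = (patternList α c).get k} =
      ∏ j, Nat.factorial (c j) := by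
  have hfib (w : List Bool) : Nat.card {k // (patternList α c).get k = w} =
      Nat.card {k // (patternList β d).get k = w} := by
    rw [card_get_eq, card_get_eq, h.count_eq]
  let f₀ := Equiv.ofFiberEquiv fun w => (Finite.card_eq.1 (hfib w)).some
  have hf₀ (k) : (patternList β d).get (f₀ k) = (patternList α c).get k :=
    Equiv.ofFiberEquiv_map _ k
  have himage : Finset.univ.image (patternList α c).get = Finset.univ.image α := by
    ext w
    simp only [Finset.mem_image, Finset.mem_univ, true_and, ← mem_patternList hc, List.mem_iff_get]
  calc _ = Nat.card {g : Equiv.Perm (Fin (patternList α c).length) //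
        (patternList α c).get ∘ g = (patternList α c).get} := by
        refine (Nat.card_congr
          ((Equiv.equivCongr (Equiv.refl _) f₀).subtypeEquiv fun g => ?_)).symm
        rw [funext_iff]
        exact forall_congr' fun k => by rw [Function.comp_apply, ← hf₀ (g k)]; rfl
    _ = _ := by
        rw [Nat.card_eq_fintype_card, DomMulAct.stabilizer_card', himage, Finset.prod_image hα.injOn]
        simp only [← Nat.card_eq_fintype_card, card_get_eq, count_patternList_apply hα]

lemma prod_factorial_eq_of_equiv {e : Fin p ≃ Fin q} (he : ∀ j, d (e j) = c j) :
    ∏ j, Nat.factorial (d j) = ∏ j, Nat.factorial (c j) := by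
  rw [← e.prod_comp]
  simp only [he]

lemma perm_of_exists_equiv {e : Fin p ≃ Fin q} (he : ∀ j, β (e j) = α j ∧ d (e j) = c j) :
    (patternList α c).Perm (patternList β d) := by
  rw [List.perm_iff_count]
  intro w
  rw [count_patternList, count_patternList, ← e.sum_comp]
  simp only [he]

end Matchings

open Classical in
/-- The approximate Fock vectors become asymptotically orthonormal:
`⟨𝐦; n | 𝐧; n⟩ → δ_{𝐦,𝐧}` as `n → ∞`, where counts are represented by finitely many
distinct patterns (binary strings starting and ending with `1`) with strictly positive
multiplicities, and `δ_{𝐦,𝐧} = 1` iff the two count assignments coincide. -/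
theorem stmt12 (p q : ℕ)
    (α : Fin p → List Bool) (β : Fin q → List Bool)
    (hα : ∀ j, (α j).head? = some true ∧ (α j).getLast? = some true)
    (hβ : ∀ j, (β j).head? = some true ∧ (β j).getLast? = some true)
    (hαinj : Function.Injective α) (hβinj : Function.Injective β)
    (c : Fin p → ℕ) (d : Fin q → ℕ) (hc : ∀ j, 0 < c j) (hd : ∀ j, 0 < d j) :
    Filter.Tendsto
      (fun n : ℕ => ∑' S : Finset ℕ, (starRingEnd ℂ) (fock n β d S) * fock n α c S)
      Filter.atTop
      (nhds (if ∃ e : Fin p ≃ Fin q, ∀ j, β (e j) = α j ∧ d (e j) = c j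
        then (1 : ℂ) else 0)) := by
  have hL {r : ℕ} {γ : Fin r → List Bool} {m : Fin r → ℕ} (hm : ∀ j, 0 < m j)
      (hγ : ∀ j, (γ j).head? = some true ∧ (γ j).getLast? = some true)
      (k : Fin (patternList γ m).length) : ((patternList γ m).get k).head? = some true ∧
        ((patternList γ m).get k).getLast? = some true := by
    obtain ⟨j, hj⟩ := (mem_patternList hm).1 (List.get_mem (patternList γ m) k)
    exact hj ▸ hγ j
  have hlim := tendsto_card_coincidences (hL hc hα) (hL hd hβ)
  simp only [Fintype.card_fin] at hlim
  simp only [tsum_conj_fock_mul_fock]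
  refine (Complex.continuous_ofReal.tendsto' _ _ ?_).comp (hlim.const_mul _)
  split_ifs with h
  · obtain ⟨e, he⟩ := h
    rw [card_matchings hαinj hc (perm_of_exists_equiv he),
      prod_factorial_eq_of_equiv fun j => (he j).2, ← mul_inv, Real.mul_self_sqrt (by positivity),
      inv_mul_cancel₀, Complex.ofReal_one]
    exact_mod_cast (Finset.prod_pos fun j _ => Nat.factorial_pos (c j)).ne'
  · have : IsEmpty {f : Fin (patternList α c).length ≃ Fin (patternList β d).length //
        ∀ k, (patternList β d).get (f k) = (patternList α c).get k} :=
      ⟨fun f => h (exists_equiv_of_perm hαinj hβinj hc hd (perm_of_equiv f.1 f.2))⟩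
    rw [Nat.card_of_isEmpty]
    simp
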